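/- A finite simple graph G belongs to the class 𝒮 if and only if G is connected, has minimum degree δ(G) ≥ 2, and contains no subgraph (not necessarily induced) isomorphic to T₆, to the path P₈ on 8 vertices, or to a cycle C_m for any m ≥ 3 with m ≠ 4. -/

import Mathlib

/-- Vertex type of `S(i₁,…,i_k)` (with `i_j = f j`): `Sum.inl none = v`,
`Sum.inl (some j) = v_j`, `Sum.inr ⟨j, r⟩ = x_j^r`. -/
abbrev SV (k : ℕ) (f : Fin k → ℕ) := Option (Fin k) ⊕ (Σ j : Fin k, Fin (f j))

/-- The graph `S(i₁,…,i_k)`: edges are exactly `v x_j^r` and `v_j x_j^r`. -/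
def Sgraph (k : ℕ) (f : Fin k → ℕ) : SimpleGraph (SV k f) :=
  SimpleGraph.fromRel (fun a b =>
    match a, b with
    | Sum.inl none, Sum.inr _ => True
    | Sum.inl (some j), Sum.inr x => j = x.1
    | _, _ => False)

/-- The class `𝒮`: graphs isomorphic to some `S(i₁,…,i_k)` with `k ≥ 1` and all `i_j ≥ 2`. -/
def inS {V : Type*} (G : SimpleGraph V) : Prop :=
  ∃ (k : ℕ) (f : Fin k → ℕ), 1 ≤ k ∧ (∀ j, 2 ≤ f j) ∧ Nonempty (G ≃g Sgraph k f)

/-- `G` contains a subgraph (not necessarily induced) isomorphic to `H`. -/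
def containsSub {VH VG : Type*} (H : SimpleGraph VH) (G : SimpleGraph VG) : Prop :=
  ∃ φ : VH → VG, Function.Injective φ ∧ ∀ a b, H.Adj a b → G.Adj (φ a) (φ b)

/-- The tree `T₆`: an edge `0 1` with pendant vertices `2, 3` attached to `0`
and pendant vertices `4, 5` attached to `1`. -/
def T6 : SimpleGraph (Fin 6) :=
  SimpleGraph.fromRel (fun a b =>
    (a = 0 ∧ b = 1) ∨ (a = 0 ∧ b = 2) ∨ (a = 0 ∧ b = 3) ∨
    (a = 1 ∧ b = 4) ∨ (a = 1 ∧ b = 5))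

/-- The cycle `C_m` on `Fin m` (for `m ≥ 3`). -/
def cycleG (m : ℕ) : SimpleGraph (Fin m) :=
  SimpleGraph.fromRel (fun a b => (b : ℕ) = ((a : ℕ) + 1) % m)

theorem aux_two {V : Type*} [Fintype V] (G : SimpleGraph V) (x : V) :
    2 ≤ (G.neighborSet x).ncard ↔ ∃ a b, G.Adj x a ∧ G.Adj x b ∧ a ≠ b := by
  have h : 2 ≤ (G.neighborSet x).ncard ↔ 1 < (G.neighborSet x).ncard := Iff.rfl
  rw [h, Set.one_lt_ncard_iff (Set.toFinite _)]
  simp [SimpleGraph.mem_neighborSet]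

section fwd
variable {V : Type*} (G : SimpleGraph V) (v : V) (X : V → Prop)

theorem fwd_seven
    (h2 : ∀ x a b, X x → G.Adj x a → G.Adj x b → a ≠ v → b ≠ v → a = b)
    (hX : ∀ a b, G.Adj a b → (X a ↔ ¬ X b))
    (q : ℕ → V) (hq : ∀ i < 6, G.Adj (q i) (q (i+1)))
    (n2 : ∀ i < 5, q i ≠ q (i+2)) (n4 : ∀ i < 3, q i ≠ q (i+4)) (h1 : X (q 1)) : False := by
  have a0 := hq 0 (by norm_num)
  have a1 := hq 1 (by norm_num)
  have a2 := hq 2 (by norm_num)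
  have a3 := hq 3 (by norm_num)
  have a4 := hq 4 (by norm_num)
  have a5 := hq 5 (by norm_num)
  have m0 := n2 0 (by norm_num)
  have m2 := n2 2 (by norm_num)
  have m4 := n2 4 (by norm_num)
  have k0 := n4 0 (by norm_num)
  have k2 := n4 2 (by norm_num)
  norm_num at *
  have x2 := hX _ _ a1
  have x3 := hX _ _ a2
  have x4 := hX _ _ a3
  have x5 := hX _ _ a4
  have e1 := h2 _ _ _ (by tauto) a0.symm a1
  have e3 := h2 (q 3) _ _ (by tauto) a2.symm a3
  have e5 := h2 (q 5) _ _ (by tauto) a4.symm a5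
  by_cases c2 : q 2 = v
  · by_cases c4 : q 4 = v
    · exact m2 (c2.trans c4.symm)
    · by_cases c6 : q 6 = v
      · exact k2 (c2.trans c6.symm)
      · exact m4 (e5 c4 c6)
  · by_cases c4 : q 4 = v
    · by_cases c0 : q 0 = v
      · exact k0 (c0.trans c4.symm)
      · exact m0 (e1 c0 c2)
    · exact m2 (e3 c2 c4)

theorem fwd_eight
    (h2 : ∀ x a b, X x → G.Adj x a → G.Adj x b → a ≠ v → b ≠ v → a = b)
    (hX : ∀ a b, G.Adj a b → (X a ↔ ¬ X b))
    (q : ℕ → V) (hq : ∀ i < 7, G.Adj (q i) (q (i+1)))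
    (n2 : ∀ i < 6, q i ≠ q (i+2)) (n4 : ∀ i < 4, q i ≠ q (i+4)) : False := by
  by_cases h1 : X (q 1)
  · exact fwd_seven G v X h2 hX q (fun i hi => hq i (by omega)) (fun i hi => n2 i (by omega))
      (fun i hi => n4 i (by omega)) h1
  · have := hX _ _ (hq 1 (by norm_num))
    exact fwd_seven G v X h2 hX (fun i => q (i+1)) (fun i hi => hq (i+1) (by omega))
      (fun i hi => n2 (i+1) (by omega)) (fun i hi => n4 (i+1) (by omega)) (by tauto)

theorem fwd_T6
    (h2 : ∀ x a b, X x → G.Adj x a → G.Adj x b → a ≠ v → b ≠ v → a = b)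
    (hX : ∀ a b, G.Adj a b → (X a ↔ ¬ X b)) : ¬ containsSub T6 G := by
  rintro ⟨φ, hi, ha⟩
  have key : ∀ x a b c : V, X x → G.Adj x a → G.Adj x b → G.Adj x c → a ≠ b → a ≠ c → b ≠ c →
      False := by
    intro x a b c hx xa xb xc ab ac bc
    have e1 := h2 x a b hx xa xb
    have e2 := h2 x a c hx xa xc
    have e3 := h2 x b c hx xb xc
    by_cases a = v <;> by_cases b = v <;> by_cases c = v <;> simp_all
  have t01 := ha 0 1 (by simp [T6])
  have t02 := ha 0 2 (by simp [T6])
  have t03 := ha 0 3 (by simp [T6])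
  have t14 := ha 1 4 (by simp [T6])
  have t15 := ha 1 5 (by simp [T6])
  have := hX _ _ t01
  by_cases h : X (φ 0)
  · exact key _ _ _ _ h t01 t02 t03 (hi.ne (by decide)) (hi.ne (by decide)) (hi.ne (by decide))
  · exact key (φ 1) _ _ _ (by tauto) t01.symm t14 t15 (hi.ne (by decide)) (hi.ne (by decide))
      (hi.ne (by decide))

theorem fwd_P8
    (h2 : ∀ x a b, X x → G.Adj x a → G.Adj x b → a ≠ v → b ≠ v → a = b)
    (hX : ∀ a b, G.Adj a b → (X a ↔ ¬ X b)) :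
    ¬ containsSub (SimpleGraph.pathGraph 8) G := by
  rintro ⟨φ, hi, ha⟩
  refine fwd_eight G v X h2 hX (fun i => φ (Fin.ofNat 8 i)) ?_ ?_ ?_
  · intro i hi'
    apply ha
    rw [SimpleGraph.pathGraph_adj]
    left
    simp only [Fin.val_ofNat]
    omega
  · intro i hi' h
    have := congrArg Fin.val (hi h)
    simp only [Fin.val_ofNat] at this
    omega
  · intro i hi' h
    have := congrArg Fin.val (hi h)
    simp only [Fin.val_ofNat] at this
    omega

theorem fwd_C
    (h2 : ∀ x a b, X x → G.Adj x a → G.Adj x b → a ≠ v → b ≠ v → a = b)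
    (hX : ∀ a b, G.Adj a b → (X a ↔ ¬ X b)) (m : ℕ) (hm : 3 ≤ m) (hm4 : m ≠ 4) :
    ¬ containsSub (cycleG m) G := by
  rintro ⟨φ, hi, ha⟩
  have hpos : 0 < m := by omega
  have mod_ne : ∀ i d, d < 2 * m → d ≠ 0 → d ≠ m → i % m ≠ (i + d) % m := by
    intro i d hd h0 hdm h
    have : i ≡ i + d [MOD m] := h
    have h3 : m ∣ d := by
      have := (Nat.modEq_iff_dvd' (by omega)).1 this
      simpa using this
    obtain ⟨c, rfl⟩ := h3
    have : c < 2 := by nlinarith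
    interval_cases c <;> simp_all
  refine fwd_eight G v X h2 hX (fun i => φ ⟨i % m, Nat.mod_lt _ hpos⟩) ?_ ?_ ?_
  · intro i _
    apply ha
    rw [cycleG, SimpleGraph.fromRel_adj]
    refine ⟨fun h => mod_ne i 1 (by omega) (by omega) (by omega) (congrArg Fin.val h), Or.inl ?_⟩
    simp
  · intro i _ h
    exact mod_ne i 2 (by omega) (by omega) (by omega) (congrArg Fin.val (hi h))
  · intro i _ h
    exact mod_ne i 4 (by omega) (by omega) (by omega) (congrArg Fin.val (hi h))

end fwd

theorem S_adj_v {k : ℕ} {f : Fin k → ℕ} (x : Σ j : Fin k, Fin (f j)) :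
    (Sgraph k f).Adj (Sum.inl none) (Sum.inr x) := by simp [Sgraph]

theorem S_adj_vj {k : ℕ} {f : Fin k → ℕ} (j : Fin k) (x : Σ j : Fin k, Fin (f j)) :
    (Sgraph k f).Adj (Sum.inl (some j)) (Sum.inr x) ↔ j = x.1 := by simp [Sgraph]

theorem S_adj_ll {k : ℕ} {f : Fin k → ℕ} (a b : Option (Fin k)) :
    ¬ (Sgraph k f).Adj (Sum.inl a) (Sum.inl b) := by
  rcases a with _ | a <;> rcases b with _ | b <;> simp [Sgraph]

theorem S_adj_rr {k : ℕ} {f : Fin k → ℕ} (a b : Σ j : Fin k, Fin (f j)) :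
    ¬ (Sgraph k f).Adj (Sum.inr a) (Sum.inr b) := by
  simp [Sgraph]

theorem S_conn {k : ℕ} {f : Fin k → ℕ} (hf : ∀ j, 2 ≤ f j) : (Sgraph k f).Connected := by
  rw [SimpleGraph.connected_iff_exists_forall_reachable]
  refine ⟨Sum.inl none, ?_⟩
  rintro ((_ | j) | x)
  · exact SimpleGraph.Reachable.refl _
  · have h := hf j
    have h1 := S_adj_v (f := f) ⟨j, ⟨0, by omega⟩⟩
    have h2 := (S_adj_vj (f := f) j ⟨j, ⟨0, by omega⟩⟩).2 rfl
    exact h1.reachable.trans h2.symm.reachable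
  · exact (S_adj_v x).reachable

theorem S_deg {k : ℕ} {f : Fin k → ℕ} (hk : 1 ≤ k) (hf : ∀ j, 2 ≤ f j) (x : SV k f) :
    ∃ a b, (Sgraph k f).Adj x a ∧ (Sgraph k f).Adj x b ∧ a ≠ b := by
  rcases x with (_ | j) | x
  · have h := hf ⟨0, hk⟩
    exact ⟨Sum.inr ⟨⟨0, hk⟩, ⟨0, by omega⟩⟩, Sum.inr ⟨⟨0, hk⟩, ⟨1, by omega⟩⟩,
      S_adj_v _, S_adj_v _, by simp⟩
  · have h := hf j
    exact ⟨Sum.inr ⟨j, ⟨0, by omega⟩⟩, Sum.inr ⟨j, ⟨1, by omega⟩⟩,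
      (S_adj_vj _ _).2 rfl, (S_adj_vj _ _).2 rfl, by simp⟩
  · exact ⟨Sum.inl none, Sum.inl (some x.1), (S_adj_v _).symm, ((S_adj_vj _ _).2 rfl).symm,
      by simp⟩

theorem inS_fwd {V : Type*} [Fintype V] (G : SimpleGraph V) (h : inS G) :
    G.Connected ∧ (∀ x : V, 2 ≤ (G.neighborSet x).ncard) ∧
      ¬ containsSub T6 G ∧ ¬ containsSub (SimpleGraph.pathGraph 8) G ∧
      ∀ m : ℕ, 3 ≤ m → m ≠ 4 → ¬ containsSub (cycleG m) G := by
  obtain ⟨k, f, hk, hf, ⟨e⟩⟩ := h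
  have h2 : ∀ x a b, (e x).isRight → G.Adj x a → G.Adj x b → a ≠ e.symm (Sum.inl none) →
      b ≠ e.symm (Sum.inl none) → a = b := by
    intro x a b hx xa xb ha hb
    rw [← e.map_adj_iff] at xa xb
    replace ha : e a ≠ Sum.inl none := fun h => ha (by rw [← h]; simp)
    replace hb : e b ≠ Sum.inl none := fun h => hb (by rw [← h]; simp)
    apply e.injective
    generalize e a = a at *
    generalize e b = b at *
    generalize e x = x at *
    rcases x with x | x
    · simp at hx
    rcases a with (_ | a) | a
    · exact absurd rfl ha
    · rcases b with (_ | b) | b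
      · exact absurd rfl hb
      · rw [(S_adj_vj _ _).1 xa.symm, (S_adj_vj _ _).1 xb.symm]
      · exact absurd xb (S_adj_rr _ _)
    · exact absurd xa (S_adj_rr _ _)
  have hX : ∀ a b, G.Adj a b → ((e a).isRight ↔ ¬ (e b).isRight) := by
    intro a b hab
    rw [← e.map_adj_iff] at hab
    generalize e a = a at *
    generalize e b = b at *
    rcases a with a | a <;> rcases b with b | b
    · exact absurd hab (S_adj_ll _ _)
    · simp
    · simp
    · exact absurd hab (S_adj_rr _ _)
  refine ⟨e.connected_iff.2 (S_conn hf), ?_, fwd_T6 G _ _ h2 hX, fwd_P8 G _ _ h2 hX,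
    fwd_C G _ _ h2 hX⟩
  intro x
  rw [aux_two]
  obtain ⟨a, b, xa, xb, ab⟩ := S_deg hk hf (e x)
  refine ⟨e.symm a, e.symm b, ?_, ?_, by simpa using ab⟩
  · rw [← e.map_adj_iff]; simpa using xa
  · rw [← e.map_adj_iff]; simpa using xb

section bwd
variable {V : Type*} (G : SimpleGraph V)

theorem inj_of_nodup {n : ℕ} (g : Fin n → V) (h : (List.ofFn g).Nodup) : Function.Injective g :=
  List.nodup_ofFn.1 h

theorem mk_C3 (h : ¬ containsSub (cycleG 3) G) (a b c : V) (ab : G.Adj a b) (bc : G.Adj b c)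
    (ca : G.Adj c a) : False := by
  apply h
  refine ⟨![a, b, c], inj_of_nodup _ ?_, ?_⟩
  · have := ab.ne; have := bc.ne; have := ca.ne; simp; tauto
  · intro i j
    fin_cases i <;> fin_cases j <;> simp [cycleG, ab, bc, ca, ab.symm, bc.symm, ca.symm]

theorem mk_C5 (h : ¬ containsSub (cycleG 5) G) (a b c d e : V) (ab : G.Adj a b) (bc : G.Adj b c)
    (cd : G.Adj c d) (de : G.Adj d e) (ea : G.Adj e a) (hn : [a, b, c, d, e].Nodup) : False := by
  apply h
  refine ⟨![a, b, c, d, e], inj_of_nodup _ (by simpa using hn), ?_⟩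
  intro i j
  fin_cases i <;> fin_cases j <;>
    simp [cycleG, ab, bc, cd, de, ea, ab.symm, bc.symm, cd.symm, de.symm, ea.symm]

theorem mk_C6 (h : ¬ containsSub (cycleG 6) G) (a b c d e f : V) (ab : G.Adj a b)
    (bc : G.Adj b c) (cd : G.Adj c d) (de : G.Adj d e) (ef : G.Adj e f) (fa : G.Adj f a)
    (hn : [a, b, c, d, e, f].Nodup) : False := by
  apply h
  refine ⟨![a, b, c, d, e, f], inj_of_nodup _ (by simpa using hn), ?_⟩
  intro i j
  fin_cases i <;> fin_cases j <;>
    simp [cycleG, ab, bc, cd, de, ef, fa, ab.symm, bc.symm, cd.symm, de.symm, ef.symm, fa.symm]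

theorem mk_C7 (h : ¬ containsSub (cycleG 7) G) (a b c d e f g : V) (ab : G.Adj a b)
    (bc : G.Adj b c) (cd : G.Adj c d) (de : G.Adj d e) (ef : G.Adj e f) (fg : G.Adj f g)
    (ga : G.Adj g a) (hn : [a, b, c, d, e, f, g].Nodup) : False := by
  apply h
  refine ⟨![a, b, c, d, e, f, g], inj_of_nodup _ (by simpa using hn), ?_⟩
  intro i j
  fin_cases i <;> fin_cases j <;>
    simp [cycleG, ab, bc, cd, de, ef, fg, ga, ab.symm, bc.symm, cd.symm, de.symm, ef.symm,
      fg.symm, ga.symm]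

theorem mk_P8 (h : ¬ containsSub (SimpleGraph.pathGraph 8) G) (a b c d e f g k : V)
    (ab : G.Adj a b)
    (bc : G.Adj b c) (cd : G.Adj c d) (de : G.Adj d e) (ef : G.Adj e f) (fg : G.Adj f g)
    (gk : G.Adj g k) (hn : [a, b, c, d, e, f, g, k].Nodup) : False := by
  apply h
  refine ⟨![a, b, c, d, e, f, g, k], inj_of_nodup _ (by simpa using hn), ?_⟩
  intro i j
  rw [SimpleGraph.pathGraph_adj]
  fin_cases i <;> fin_cases j <;>
    simp [ab, bc, cd, de, ef, fg, gk, ab.symm, bc.symm, cd.symm, de.symm, ef.symm,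
      fg.symm, gk.symm]

theorem mk_T6 (h : ¬ containsSub T6 G) (a b c d e f : V)
    (ab : G.Adj a b) (ac : G.Adj a c) (ad : G.Adj a d) (be : G.Adj b e) (bf : G.Adj b f)
    (hn : [a, b, c, d, e, f].Nodup) : False := by
  apply h
  refine ⟨![a, b, c, d, e, f], inj_of_nodup _ (by simpa using hn), ?_⟩
  intro i j
  fin_cases i <;> fin_cases j <;>
    simp [T6, ab, ac, ad, be, bf, ab.symm, ac.symm, ad.symm, be.symm, bf.symm]

end bwd

theorem inS_of_center {V : Type*} [Fintype V] (G : SimpleGraph V) (v : V)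
    (hdeg : ∀ x, ∃ a b, G.Adj x a ∧ G.Adj x b ∧ a ≠ b)
    (h3 : ∀ a b c, G.Adj a b → G.Adj b c → G.Adj c a → False)
    (hD : ∀ x a b, G.Adj v x → G.Adj x a → G.Adj x b → a ≠ v → b ≠ v → a = b)
    (hC : ∀ w y, w ≠ v → ¬ G.Adj v w → G.Adj w y → G.Adj v y) : inS G := by
  classical
  let W := {w : V // w ≠ v ∧ ¬ G.Adj v w}
  let e : Fin (Fintype.card W) ≃ W := (Fintype.equivFin W).symm
  let f : Fin (Fintype.card W) → ℕ := fun j => Fintype.card (G.neighborSet (e j).1)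
  let E : ∀ j, Fin (f j) ≃ G.neighborSet (e j).1 := fun j => (Fintype.equivFin _).symm
  have hE : ∀ j r, G.Adj (e j).1 (E j r).1 := fun j r => (E j r).2
  have hEv : ∀ j r, G.Adj v (E j r).1 := fun j r => hC _ _ (e j).2.1 (e j).2.2 (hE j r)
  have hother : ∀ x, G.Adj v x → ∃ j, G.Adj (e j).1 x := by
    intro x hx
    have : ∃ w, w ≠ v ∧ G.Adj x w := by
      obtain ⟨a, b, xa, xb, ab⟩ := hdeg x
      by_cases c : a = v
      · exact ⟨b, fun h => ab (c.trans h.symm), xb⟩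
      · exact ⟨a, c, xa⟩
    obtain ⟨w, wv, xw⟩ := this
    refine ⟨e.symm ⟨w, wv, fun h => h3 _ _ _ hx xw h.symm⟩, ?_⟩
    simpa using xw.symm
  have huniq : ∀ x i j, G.Adj v x → G.Adj (e i).1 x → G.Adj (e j).1 x → i = j := by
    intro x i j hx hi hj
    exact e.injective (Subtype.ext (hD x _ _ hx hi.symm hj.symm (e i).2.1 (e j).2.1))
  let φ : SV (Fintype.card W) f → V := fun s => match s with
    | Sum.inl none => v
    | Sum.inl (some j) => (e j).1
    | Sum.inr x => (E x.1 x.2).1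
  have hinj : Function.Injective φ := by
    rintro ((_ | i) | ⟨i, r⟩) ((_ | j) | ⟨j, s⟩) h
    · rfl
    · exact absurd h.symm (e j).2.1
    · exact absurd h (hEv j s).ne
    · exact absurd h (e i).2.1
    · rw [e.injective (Subtype.ext h)]
    · exact absurd ((show (e i).1 = (E j s).1 from h) ▸ hEv j s) (e i).2.2
    · exact absurd h.symm (hEv i r).ne
    · exact absurd ((show (E i r).1 = (e j).1 from h) ▸ hEv i r) (e j).2.2
    · replace h : (E i r).1 = (E j s).1 := h
      have hij : i = j := huniq _ i j (hEv i r) (hE i r) (h ▸ hE j s)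
      subst hij
      rw [(E i).injective (Subtype.ext h)]
  have hsurj : Function.Surjective φ := by
    intro y
    by_cases h1 : y = v
    · exact ⟨Sum.inl none, h1.symm⟩
    by_cases h2 : G.Adj v y
    · obtain ⟨j, hj⟩ := hother y h2
      exact ⟨Sum.inr ⟨j, (E j).symm ⟨y, hj⟩⟩, by simp [φ]⟩
    · exact ⟨Sum.inl (some (e.symm ⟨y, h1, h2⟩)), by simp [φ]⟩
  have hadj : ∀ a b, G.Adj (φ a) (φ b) ↔ (Sgraph _ f).Adj a b := by
    have hll : ∀ a b, ¬ G.Adj (φ (Sum.inl a)) (φ (Sum.inl b)) := by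
      rintro (_ | i) (_ | j) h
      · exact h.ne rfl
      · exact (e j).2.2 h
      · exact (e i).2.2 h.symm
      · exact (e j).2.2 (hC _ _ (e i).2.1 (e i).2.2 h)
    have hlr : ∀ a x, G.Adj (φ (Sum.inl a)) (φ (Sum.inr x)) ↔
        (Sgraph _ f).Adj (Sum.inl a) (Sum.inr x) := by
      rintro (_ | i) ⟨j, s⟩
      · exact iff_of_true (hEv j s) (S_adj_v _)
      · rw [S_adj_vj]
        constructor
        · intro h
          exact huniq _ i j (hEv j s) h (hE j s)
        · rintro rfl
          exact hE _ s
    have hrr : ∀ a b, ¬ G.Adj (φ (Sum.inr a)) (φ (Sum.inr b)) := by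
      rintro ⟨i, r⟩ ⟨j, s⟩ h
      exact h3 _ _ _ (hEv i r) h (hEv j s).symm
    rintro (a | a) (b | b)
    · exact iff_of_false (hll _ _) (S_adj_ll _ _)
    · exact hlr _ _
    · rw [G.adj_comm, hlr, SimpleGraph.adj_comm]
    · exact iff_of_false (hrr _ _) (S_adj_rr _ _)
  refine ⟨Fintype.card W, f, ?_, ?_, ⟨(RelIso.symm ⟨Equiv.ofBijective φ ⟨hinj, hsurj⟩, ?_⟩)⟩⟩
  · obtain ⟨x, _, hx, _⟩ := hdeg v
    obtain ⟨j, _⟩ := hother x hx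
    exact Fin.pos j
  · intro j
    obtain ⟨a, b, ha, hb, ab⟩ := hdeg (e j).1
    exact Fintype.one_lt_card_iff.2 ⟨⟨a, ha⟩, ⟨b, hb⟩, fun h => ab (congrArg Subtype.val h)⟩
  · intro a b
    exact hadj a b

theorem inS_bwd {V : Type*} [Fintype V] (G : SimpleGraph V) (hconn : G.Connected)
    (hdeg : ∀ x, ∃ a b, G.Adj x a ∧ G.Adj x b ∧ a ≠ b)
    (hT : ¬ containsSub T6 G) (hP : ¬ containsSub (SimpleGraph.pathGraph 8) G)
    (hCy : ∀ m : ℕ, 3 ≤ m → m ≠ 4 → ¬ containsSub (cycleG m) G) : inS G := by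
  classical
  have h3 := mk_C3 G (hCy 3 (by norm_num) (by norm_num))
  have h5 := mk_C5 G (hCy 5 (by norm_num) (by norm_num))
  have h6 := mk_C6 G (hCy 6 (by norm_num) (by norm_num))
  have h7 := mk_C7 G (hCy 7 (by norm_num) (by norm_num))
  have h8 := mk_P8 G hP
  have hT6 := mk_T6 G hT
  have hdeg' : ∀ x c, ∃ a, G.Adj x a ∧ a ≠ c := by
    intro x c
    obtain ⟨a, b, xa, xb, ab⟩ := hdeg x
    by_cases h : a = c
    · exact ⟨b, xb, fun h' => ab (h.trans h'.symm)⟩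
    · exact ⟨a, xa, h⟩
  haveI := hconn.nonempty
  obtain ⟨v, hv⟩ := Finite.exists_max (fun x : V => (G.neighborFinset x).card)
  have hD : ∀ x a b, G.Adj v x → G.Adj x a → G.Adj x b → a ≠ v → b ≠ v → a = b := by
    intro x a b vx xa xb av bv
    by_contra ab
    have hc : 2 < (G.neighborFinset v).card := by
      refine lt_of_lt_of_le ?_ (hv x)
      rw [Finset.two_lt_card]
      exact ⟨v, by simpa using vx.symm, a, by simpa using xa, b, by simpa using xb,
        av.symm, bv.symm, ab⟩
    have : 1 < ((G.neighborFinset v).erase x).card := by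
      rw [Finset.card_erase_of_mem (by simpa using vx)]; omega
    obtain ⟨c, hc, d, hd, cd⟩ := Finset.one_lt_card.1 this
    simp only [Finset.mem_erase, SimpleGraph.mem_neighborFinset] at hc hd
    have ca : c ≠ a := fun h => h3 v x a vx xa (h ▸ hc.2).symm
    have cb : c ≠ b := fun h => h3 v x b vx xb (h ▸ hc.2).symm
    have da : d ≠ a := fun h => h3 v x a vx xa (h ▸ hd.2).symm
    have db : d ≠ b := fun h => h3 v x b vx xb (h ▸ hd.2).symm
    have := vx.ne
    have := hc.2.ne
    have := hd.2.ne
    have := xa.ne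
    have := xb.ne
    refine hT6 v x c d a b vx hc.2 hd.2 xa xb ?_
    simp
    grind
  have hB : ∀ x w y, G.Adj v x → G.Adj x w → w ≠ v → G.Adj w y → G.Adj v y := by
    intro x w y vx xw wv wy
    by_contra vy
    have nvw : ¬ G.Adj v w := fun h => h3 _ _ _ vx xw h.symm
    have yv : y ≠ v := fun h => nvw (h ▸ wy).symm
    have yx : y ≠ x := fun h => vy (h ▸ vx)
    obtain ⟨z, yz, zw⟩ := hdeg' y w
    have zx : z ≠ x := fun h => h3 _ _ _ xw wy (h ▸ yz)
    have zv : z ≠ v := fun h => vy (h ▸ yz).symm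
    have nvx := vx.ne
    have nxw := xw.ne
    have nwy := wy.ne
    have nyz := yz.ne
    have nvz : ¬ G.Adj v z := fun h => h5 v x w y z vx xw wy yz h.symm (by simp; grind)
    have hall : ∀ x', G.Adj v x' → G.Adj w x' := by
      intro x' vx'
      by_contra nwx'
      have x'x : x' ≠ x := fun h => nwx' (h ▸ xw.symm)
      have x'w : x' ≠ w := fun h => nvw (h ▸ vx')
      have x'y : x' ≠ y := fun h => vy (h ▸ vx')
      have x'z : x' ≠ z := fun h => nvz (h ▸ vx')
      have nvx' := vx'.ne
      obtain ⟨u, x'u, uv⟩ := hdeg' x' v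
      have nx'u := x'u.ne
      have ux : u ≠ x := fun h => h3 _ _ _ vx' (h ▸ x'u) vx.symm
      have uw : u ≠ w := fun h => nwx' (h ▸ x'u).symm
      have uy : u ≠ y := fun h => h5 x' v x w y vx'.symm vx xw wy (h ▸ x'u).symm (by simp; grind)
      have x'nz : ¬ G.Adj x' z := fun h =>
        h6 x' v x w y z vx'.symm vx xw wy yz h.symm (by simp; grind)
      have uz : u ≠ z := fun h => x'nz (h ▸ x'u)
      obtain ⟨t, zt, ty⟩ := hdeg' z y
      have nzt := zt.ne
      have tw : t ≠ w := fun h => h3 _ _ _ wy yz (h ▸ zt)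
      have tx : t ≠ x := fun h => zw (hD x z w vx (h ▸ zt).symm xw zv wv)
      have tv : t ≠ v := fun h => nvz (h ▸ zt).symm
      have tx' : t ≠ x' := fun h => x'nz (h ▸ zt).symm
      have tu : t ≠ u := fun h => h7 u x' v x w y z x'u.symm vx'.symm vx xw wy yz (h ▸ zt)
        (by simp; grind)
      exact h8 u x' v x w y z t x'u.symm vx'.symm vx xw wy yz zt (by simp; grind)
    have : (G.neighborFinset v).card < (G.neighborFinset w).card := by
      apply Finset.card_lt_card
      rw [Finset.ssubset_iff_of_subset]
      · exact ⟨y, by simpa using wy, by simpa using vy⟩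
      · intro x' hx'
        simpa using hall x' (by simpa using hx')
    exact absurd (hv w) (not_le.2 this)
  have hR : ∀ u, u = v ∨ G.Adj v u ∨ ∃ x, G.Adj v x ∧ G.Adj x u := by
    intro u
    have := hconn.preconnected v u
    rw [SimpleGraph.reachable_iff_reflTransGen] at this
    induction this with
    | refl => exact Or.inl rfl
    | tail _ hbc ih =>
      rename_i b c _
      rcases ih with rfl | h | ⟨x, vx, xb⟩
      · exact Or.inr (Or.inl hbc)
      · exact Or.inr (Or.inr ⟨b, h, hbc⟩)
      · by_cases bv : b = v
        · exact Or.inr (Or.inl (bv ▸ hbc))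
        · exact Or.inr (Or.inl (hB x b c vx xb bv hbc))
  apply inS_of_center G v hdeg h3 hD
  intro w y wv nvw wy
  rcases hR w with h | h | ⟨x, vx, xw⟩
  · exact absurd h wv
  · exact absurd h nvw
  · exact hB x w y vx xw wv wy

/-- `G ∈ 𝒮` iff `G` is connected, has minimum degree at least 2, and contains no
subgraph isomorphic to `T₆`, to `P₈`, or to `C_m` for any `m ≥ 3` with `m ≠ 4`. -/
theorem stmt_15 {V : Type*} [Fintype V] (G : SimpleGraph V) :
    inS G ↔
      G.Connected ∧ (∀ x : V, 2 ≤ (G.neighborSet x).ncard) ∧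
      ¬ containsSub T6 G ∧ ¬ containsSub (SimpleGraph.pathGraph 8) G ∧
      ∀ m : ℕ, 3 ≤ m → m ≠ 4 → ¬ containsSub (cycleG m) G := by
  constructor
  · exact inS_fwd G
  · rintro ⟨hc, hd, hT, hP, hCy⟩
    exact inS_bwd G hc (fun x => (aux_two G x).1 (hd x)) hT hP hCy
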